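/- Let Q be a cube in ℝ^n with sides parallel to the axes and let p₀ satisfy 1 < p₀ < ∞. Then the following three sets of measurable functions on Q coincide: (1) 𝓜_{A₁}(Q), the functions possessing an A₁(Q) majorant; (2) the union over p > 1 of L^p(Q); (3) the union over w ∈ A_{p₀}(Q) of L^{p₀}_w(Q). -/

import Mathlib

open MeasureTheory ENNReal

/-- A (nondegenerate) cube in `ℝⁿ` with sides parallel to the axes. -/
def IsCube {n : ℕ} (Q : Set (Fin n → ℝ)) : Prop :=
  ∃ (a : Fin n → ℝ) (l : ℝ), 0 < l ∧
    Q = Set.univ.pi fun i => Set.Icc (a i) (a i + l)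

/-- The domains considered: all of `ℝⁿ` or a cube with sides parallel to the axes. -/
def IsAdmissibleDomain {n : ℕ} (Ω : Set (Fin n → ℝ)) : Prop :=
  Ω = Set.univ ∨ IsCube Ω

/-- The Hardy–Littlewood maximal operator restricted to `Ω`:
`M_Ω f (x) = sup { (1/|Q|) ∫_Q |f| : Q ⊆ Ω a cube with x ∈ Q }`. -/
noncomputable def maximal {n : ℕ} (Ω : Set (Fin n → ℝ)) (f : (Fin n → ℝ) → ℝ)
    (x : Fin n → ℝ) : ℝ≥0∞ :=
  ⨆ (Q : Set (Fin n → ℝ)) (_ : IsCube Q) (_ : Q ⊆ Ω) (_ : x ∈ Q),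
    (volume Q)⁻¹ * ∫⁻ y in Q, ENNReal.ofReal |f y|

/-- A weight on `Ω`: a measurable function, positive a.e. on `Ω`, integrable on every
cube contained in `Ω` (hence locally integrable; integrable when `Ω` is itself a cube). -/
structure IsWeight {n : ℕ} (Ω : Set (Fin n → ℝ)) (w : (Fin n → ℝ) → ℝ) : Prop where
  measurable : Measurable w
  pos : ∀ᵐ x ∂(volume.restrict Ω), 0 < w x
  locInt : ∀ Q : Set (Fin n → ℝ), IsCube Q → Q ⊆ Ω → IntegrableOn w Q

/-- The Muckenhoupt `A₁(Ω)` class: `M_Ω w ≤ C w` a.e. on `Ω`. -/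
def MemA1 {n : ℕ} (Ω : Set (Fin n → ℝ)) (w : (Fin n → ℝ) → ℝ) : Prop :=
  IsWeight Ω w ∧ ∃ C : ℝ, ∀ᵐ x ∂(volume.restrict Ω),
    maximal Ω w x ≤ ENNReal.ofReal (C * w x)

/-- The Muckenhoupt `A_p(Ω)` class for `1 < p < ∞`:
`sup_{Q ⊆ Ω} (avg_Q w) * (avg_Q w^(1-p'))^(p-1) < ∞` where `p' = p/(p-1)`. -/
def MemApGT1 {n : ℕ} (Ω : Set (Fin n → ℝ)) (p : ℝ) (w : (Fin n → ℝ) → ℝ) : Prop :=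
  IsWeight Ω w ∧ ∃ C : ℝ≥0∞, C ≠ ∞ ∧ ∀ Q : Set (Fin n → ℝ), IsCube Q → Q ⊆ Ω →
    ((volume Q)⁻¹ * ∫⁻ x in Q, ENNReal.ofReal (w x)) *
      ((volume Q)⁻¹ * ∫⁻ x in Q, ENNReal.ofReal (w x ^ (1 - p / (p - 1)))) ^ (p - 1) ≤ C

/-- The Muckenhoupt `A_p(Ω)` class for `1 ≤ p < ∞`. -/
def MemA {n : ℕ} (Ω : Set (Fin n → ℝ)) (p : ℝ) (w : (Fin n → ℝ) → ℝ) : Prop :=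
  (p = 1 ∧ MemA1 Ω w) ∨ (1 < p ∧ MemApGT1 Ω p w)

/-- The Muckenhoupt `A_∞(Ω)` class: the union of `A_p(Ω)` over `1 ≤ p < ∞`. -/
def MemAInf {n : ℕ} (Ω : Set (Fin n → ℝ)) (w : (Fin n → ℝ) → ℝ) : Prop :=
  ∃ p : ℝ, 1 ≤ p ∧ MemA Ω p w

/-- Membership in the weighted Lebesgue space `L^p_w(Ω)`: `f` measurable with
`∫_Ω |f|^p w < ∞`. -/
def MemLw {n : ℕ} (Ω : Set (Fin n → ℝ)) (p : ℝ) (w f : (Fin n → ℝ) → ℝ) : Prop :=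
  Measurable f ∧
    ∫⁻ x in Ω, ENNReal.ofReal |f x| ^ p * ENNReal.ofReal (w x) < ⊤

/-- Membership in the (unweighted) Lebesgue space `L^p(Ω)`. -/
def MemLeb {n : ℕ} (Ω : Set (Fin n → ℝ)) (p : ℝ) (f : (Fin n → ℝ) → ℝ) : Prop :=
  MemLw Ω p (fun _ => 1) f

/-- `f ∈ 𝓜_{A_p}(Ω)`: `f` is measurable and `|f| ≤ w` a.e. on `Ω` for some `w ∈ A_p(Ω)`. -/
def HasApMajorant {n : ℕ} (Ω : Set (Fin n → ℝ)) (p : ℝ) (f : (Fin n → ℝ) → ℝ) : Prop :=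
  Measurable f ∧ ∃ w, MemA Ω p w ∧ ∀ᵐ x ∂(volume.restrict Ω), |f x| ≤ w x

/-- `f ∈ 𝓜^r_{A_p}(Ω)`: `f` is measurable and `|f|^r ≤ w` a.e. on `Ω` for some
`w ∈ A_p(Ω)`. -/
def HasApPowMajorant {n : ℕ} (Ω : Set (Fin n → ℝ)) (p r : ℝ) (f : (Fin n → ℝ) → ℝ) : Prop :=
  Measurable f ∧ ∃ w, MemA Ω p w ∧ ∀ᵐ x ∂(volume.restrict Ω), |f x| ^ r ≤ w x

/-- `f ∈ 𝓜_{A_∞}(Ω)`: `f` is measurable and `|f| ≤ w` a.e. on `Ω` for some `w ∈ A_∞(Ω)`. -/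
def HasAInfMajorant {n : ℕ} (Ω : Set (Fin n → ℝ)) (f : (Fin n → ℝ) → ℝ) : Prop :=
  Measurable f ∧ ∃ w, MemAInf Ω w ∧ ∀ᵐ x ∂(volume.restrict Ω), |f x| ≤ w x

/-- Membership in weak `L^p(ℝⁿ)`: `sup_{t>0} t · |{|f| > t}|^{1/p} < ∞`. -/
def MemWeakLp {n : ℕ} (p : ℝ) (f : (Fin n → ℝ) → ℝ) : Prop :=
  Measurable f ∧ ∃ C : ℝ≥0∞, C ≠ ⊤ ∧ ∀ t : ℝ, 0 < t →
    ENNReal.ofReal t * volume {x | t < |f x|} ^ (1 / p) ≤ C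

/-- Layer-cake estimate along a geometric sequence of levels. -/
lemma lintegral_rpow_le_tsum {X : Type*} [MeasurableSpace X] (μ : Measure X) {h : X → ℝ≥0∞}
    {m B : ℝ≥0∞} (hm : m ≠ 0) (hB : 1 ≤ B) {δ : ℝ} (hδ : 0 < δ)
    {Ω : ℕ → Set X} (hΩm : ∀ k, MeasurableSet (Ω k))
    (hΩ : ∀ᵐ x ∂μ, ∀ k, x ∉ Ω k → h x ≤ m * B ^ k) :
    ∫⁻ x, h x ^ δ ∂μ ≤ m ^ δ * (μ Set.univ + ∑' k, (B ^ δ) ^ (k + 1) * μ (Ω k)) := by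
  have hBδ : 1 ≤ B ^ δ := ENNReal.one_le_rpow hB hδ
  have hmδ : m ^ δ ≠ 0 := by simp [ENNReal.rpow_eq_zero_iff, hm, hδ.not_gt]
  have pow_comm (k : ℕ) : (B ^ k) ^ δ = (B ^ δ) ^ k := by
    rw [← ENNReal.rpow_natCast, ← ENNReal.rpow_natCast, ← ENNReal.rpow_mul, ← ENNReal.rpow_mul,
      mul_comm]
  have key : ∀ᵐ x ∂μ, h x ^ δ ≤
      m ^ δ * (1 + ∑' k, (B ^ δ) ^ (k + 1) * (Ω k).indicator 1 x) := by
    filter_upwards [hΩ] with x hx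
    by_cases hall : ∀ k, x ∈ Ω k
    · have : ∑' k, (B ^ δ) ^ (k + 1) * (Ω k).indicator (1 : X → ℝ≥0∞) x = ⊤ := by
        rw [eq_top_iff, ← ENNReal.tsum_const_eq_top_of_ne_zero (α := ℕ) one_ne_zero]
        refine ENNReal.tsum_le_tsum fun k => ?_
        simpa [hall k] using one_le_pow₀ hBδ
      simp [this, hmδ]
    · push Not at hall
      classical
      rcases hk : Nat.find hall with _ | j
      · have := Nat.find_spec hall
        rw [hk] at this
        have h0 := hx 0 this
        calc h x ^ δ ≤ m ^ δ * 1 := by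
              simpa using ENNReal.rpow_le_rpow h0 hδ.le
          _ ≤ _ := by gcongr; exact le_self_add
      · have h1 := Nat.find_spec hall
        rw [hk] at h1
        have h2 : x ∈ Ω j := by
          by_contra hc
          have := Nat.find_min' hall hc
          omega
        calc h x ^ δ ≤ (m * B ^ (j + 1)) ^ δ := ENNReal.rpow_le_rpow (hx _ h1) hδ.le
          _ = m ^ δ * ((B ^ δ) ^ (j + 1) * (Ω j).indicator (1 : X → ℝ≥0∞) x) := by
            rw [ENNReal.mul_rpow_of_nonneg _ _ hδ.le, pow_comm]; simp [h2]
          _ ≤ _ := by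
            gcongr
            exact (ENNReal.le_tsum (f := fun k => (B ^ δ) ^ (k + 1) *
              (Ω k).indicator (1 : X → ℝ≥0∞) x) j).trans le_add_self
  have hmeas (k : ℕ) : Measurable fun x => (B ^ δ) ^ (k + 1) *
      (Ω k).indicator (1 : X → ℝ≥0∞) x :=
    (measurable_one.indicator (hΩm k)).const_mul _
  refine (lintegral_mono_ae key).trans_eq ?_
  have hsum : Measurable fun x => ∑' k, (B ^ δ) ^ (k + 1) * (Ω k).indicator (1 : X → ℝ≥0∞) x :=
    Measurable.tsum hmeas
  rw [lintegral_const_mul _ (hsum.const_add 1), lintegral_add_left measurable_const, lintegral_tsum fun k => (hmeas k).aemeasurable]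
  congr 3
  · simp
  · ext k
    rw [lintegral_const_mul _ (measurable_one.indicator (hΩm k)), lintegral_indicator_one (hΩm k)]

/-- If a measure inequality holds on every maximal selected fibre of a nested sequence of countable
partitions, it holds on the union of the selected fibres. -/
lemma measure_selected_le {X ι : Type*} [MeasurableSpace X] [Countable ι] {N : ℕ → X → ι}
    (hN : ∀ k i, MeasurableSet (N k ⁻¹' {i}))
    (href : ∀ j k x y, j ≤ k → N k x = N k y → N j x = N j y) (P : ℕ → ι → Prop)
    (ρ₁ ρ₂ : Measure X)
    (h : ∀ k x, P k (N k x) → (∀ j < k, ¬ P j (N j x)) →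
      ρ₁ (N k ⁻¹' {N k x}) ≤ ρ₂ (N k ⁻¹' {N k x})) :
    ρ₁ {x | ∃ k, P k (N k x)} ≤ ρ₂ {x | ∃ k, P k (N k x)} := by
  classical
  let A : ℕ × ι → Prop := fun q => ∃ x, N q.1 x = q.2 ∧ P q.1 q.2 ∧ ∀ j < q.1, ¬ P j (N j x)
  let S : ℕ × ι → Set X := fun q => {y | N q.1 y = q.2 ∧ A q}
  have hS (q) (hq : A q) : S q = N q.1 ⁻¹' {q.2} := by ext y; simp [S, hq]
  have hS' (q) (hq : ¬ A q) : S q = ∅ := by ext y; simp [S, hq]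
  have hmeas (q) : MeasurableSet (S q) := by
    by_cases hq : A q
    · rw [hS q hq]; exact hN _ _
    · rw [hS' q hq]; exact MeasurableSet.empty
  have aux (q q' : ℕ × ι) (y : X) (hy : y ∈ S q) (hy' : y ∈ S q') : q'.1 ≤ q.1 := by
    by_contra hlt
    push Not at hlt
    obtain ⟨hy1, x, hx, hP, -⟩ := hy
    obtain ⟨hy2, x', hx', hP', hmin⟩ := hy'
    apply hmin _ hlt
    rw [href _ _ x' y hlt.le (hx'.trans hy2.symm), hy1]
    exact hP
  have hdisj : Pairwise (Function.onFun Disjoint S) := by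
    intro q q' hne
    rw [Function.onFun, Set.disjoint_left]
    intro y hy hy'
    have e : q.1 = q'.1 := le_antisymm (aux _ _ y hy' hy) (aux _ _ y hy hy')
    exact hne (Prod.ext e (by rw [← hy.1, ← hy'.1, e]))
  have hU : {x | ∃ k, P k (N k x)} = ⋃ q, S q := by
    ext x
    simp only [Set.mem_ofPred_eq, Set.mem_iUnion]
    constructor
    · intro hx
      refine ⟨(Nat.find hx, N (Nat.find hx) x), rfl, x, rfl, Nat.find_spec hx, ?_⟩
      intro j hj
      exact Nat.find_min hx hj
    · rintro ⟨q, hq, x', hx', hP, -⟩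
      exact ⟨q.1, hq ▸ hP⟩
  rw [hU, measure_iUnion hdisj hmeas, measure_iUnion hdisj hmeas]
  refine ENNReal.tsum_le_tsum fun q => ?_
  by_cases hq : A q
  · rw [hS q hq]
    obtain ⟨x, hx, hP, hmin⟩ := hq
    rw [← hx] at hP ⊢
    exact h _ _ hP hmin
  · simp [hS' q hq]

/-- Measure of the fibres selected at level `2 * A * t` against level `t` (one
Calderón–Zygmund step). -/
lemma measure_level_le {X ι : Type*} [MeasurableSpace X] [Countable ι] {N : ℕ → X → ι}
    (hN : ∀ k i, MeasurableSet (N k ⁻¹' {i}))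
    (href : ∀ j k x y, j ≤ k → N k x = N k y → N j x = N j y)
    {μ ν : Measure X} {l A β t : ℝ≥0∞}
    (h0 : ∀ x, ν (N 0 ⁻¹' {N 0 x}) ≤ l * μ (N 0 ⁻¹' {N 0 x})) (hl : l ≠ 0)
    (hA : 1 ≤ A) (hA' : A ≠ ⊤)
    (hdoub : ∀ k x, μ (N k ⁻¹' {N k x}) ≤ A * μ (N (k + 1) ⁻¹' {N (k + 1) x}))
    (hβ : ∀ k x E, MeasurableSet E → E ⊆ N k ⁻¹' {N k x} → 2 * μ E ≤ μ (N k ⁻¹' {N k x}) →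
      ν E ≤ β * ν (N k ⁻¹' {N k x}))
    (ht : l ≤ t) (ht' : t ≠ ⊤) :
    ν {x | ∃ k, 2 * A * t * μ (N k ⁻¹' {N k x}) < ν (N k ⁻¹' {N k x})} ≤
      β * ν {x | ∃ k, t * μ (N k ⁻¹' {N k x}) < ν (N k ⁻¹' {N k x})} := by
  have htt : t ≤ 2 * A * t := by
    have : 1 ≤ 2 * A := hA.trans (le_mul_of_one_le_left (by simp) (by norm_num))
    exact le_mul_of_one_le_left (by simp) this
  set U := {x | ∃ k, 2 * A * t * μ (N k ⁻¹' {N k x}) < ν (N k ⁻¹' {N k x})} with hU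
  have hUm : MeasurableSet U := by
    have : U = ⋃ k, ⋃ i, ⋃ (_ : 2 * A * t * μ (N k ⁻¹' {i}) < ν (N k ⁻¹' {i})),
        N k ⁻¹' {i} := by
      ext x
      simp [U]
    rw [this]
    exact MeasurableSet.iUnion fun k => MeasurableSet.iUnion fun i =>
      MeasurableSet.iUnion fun _ => hN k i
  set V := {x | ∃ k, t * μ (N k ⁻¹' {N k x}) < ν (N k ⁻¹' {N k x})} with hV
  have hUV : U ⊆ V := by
    rintro x ⟨k, hk⟩
    exact ⟨k, lt_of_le_of_lt (by gcongr) hk⟩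
  have main := measure_selected_le hN href
    (fun k i => t * μ (N k ⁻¹' {i}) < ν (N k ⁻¹' {i})) (ν.restrict U) (β • ν) ?_
  · change ν.restrict U V ≤ (β • ν) V at main
    rwa [Measure.restrict_apply_superset hUV] at main
  intro k x hP hmin
  rw [Measure.restrict_apply (hN _ _), Measure.smul_apply, smul_eq_mul]
  refine hβ k x _ ((hN _ _).inter hUm) Set.inter_subset_left ?_
  have weak : 2 * A * t * μ (N k ⁻¹' {N k x} ∩ U) ≤ ν (N k ⁻¹' {N k x}) := by
    have := measure_selected_le hN href
      (fun k i => 2 * A * t * μ (N k ⁻¹' {i}) < ν (N k ⁻¹' {i}))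
      ((2 * A * t) • μ.restrict (N k ⁻¹' {N k x})) (ν.restrict (N k ⁻¹' {N k x})) ?_
    · change ((2 * A * t) • μ.restrict (N k ⁻¹' {N k x})) U ≤
        ν.restrict (N k ⁻¹' {N k x}) U at this
      rw [Measure.smul_apply, smul_eq_mul, Measure.restrict_apply hUm,
        Measure.restrict_apply hUm, Set.inter_comm] at this
      exact this.trans (measure_mono Set.inter_subset_left)
    intro k' y hP' _
    rw [Measure.smul_apply, smul_eq_mul, Measure.restrict_apply (hN _ _),
      Measure.restrict_apply (hN _ _)]
    rcases Set.eq_empty_or_nonempty (N k' ⁻¹' {N k' y} ∩ N k ⁻¹' {N k x}) with he | ⟨z, hz', hz⟩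
    · simp [he]
    · simp only [Set.mem_preimage, Set.mem_singleton_iff] at hz hz'
      rcases le_or_gt k k' with hk | hk
      · have : N k' ⁻¹' {N k' y} ⊆ N k ⁻¹' {N k x} := by
          intro u hu
          simp only [Set.mem_preimage, Set.mem_singleton_iff] at hu ⊢
          rw [← hz]
          exact href _ _ _ _ hk (hu.trans hz'.symm)
        rw [Set.inter_eq_left.2 this]
        exact hP'.le
      · have e : N k' y = N k' x := hz'.symm.trans (href _ _ _ _ hk.le hz)
        rw [e] at hP'
        exact absurd (lt_of_le_of_lt (by gcongr) hP') (hmin k' hk)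
  rcases k with _ | j
  · exact absurd hP (not_lt.2 ((h0 x).trans (by gcongr)))
  · have h1 : ν (N (j + 1) ⁻¹' {N (j + 1) x}) ≤ t * A * μ (N (j + 1) ⁻¹' {N (j + 1) x}) := by
      calc ν (N (j + 1) ⁻¹' {N (j + 1) x}) ≤ ν (N j ⁻¹' {N j x}) := by
            apply measure_mono
            intro u hu
            exact href _ _ _ _ (Nat.le_succ j) hu
        _ ≤ t * μ (N j ⁻¹' {N j x}) := not_lt.1 (hmin j (Nat.lt_succ_self j))
        _ ≤ t * (A * μ (N (j + 1) ⁻¹' {N (j + 1) x})) := by gcongr; exact hdoub j x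
        _ = _ := by ring
    have h2 : t * A * (2 * μ (N (j + 1) ⁻¹' {N (j + 1) x} ∩ U)) ≤
        t * A * μ (N (j + 1) ⁻¹' {N (j + 1) x}) := by
      refine le_trans (le_of_eq ?_) (weak.trans h1)
      ring
    rwa [ENNReal.mul_le_mul_iff_right] at h2
    · exact mul_ne_zero ((lt_of_lt_of_le (pos_iff_ne_zero.2 hl) ht).ne')
        (lt_of_lt_of_le one_pos hA).ne'
    · exact ENNReal.mul_ne_top ht' hA'

/-- Self-improvement of integrability along a nested sequence of countable partitions, under an
`A_∞`-type condition on the fibres. -/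
theorem exists_lintegral_rpow_lt_top_of_partitions {X ι : Type*} [MeasurableSpace X] [Countable ι]
    {N : ℕ → X → ι}
    (hN : ∀ k i, MeasurableSet (N k ⁻¹' {i}))
    (href : ∀ j k x y, j ≤ k → N k x = N k y → N j x = N j y)
    {μ ν : Measure X} {g : X → ℝ≥0∞} (hg : Measurable g) (hν : ν = μ.withDensity g)
    (hfin : ν Set.univ ≠ ⊤) {l A β : ℝ≥0∞}
    (h0 : ∀ x, ν (N 0 ⁻¹' {N 0 x}) ≤ l * μ (N 0 ⁻¹' {N 0 x})) (hl : l ≠ 0) (hl' : l ≠ ⊤)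
    (hA : 1 ≤ A) (hA' : A ≠ ⊤)
    (hdoub : ∀ k x, μ (N k ⁻¹' {N k x}) ≤ A * μ (N (k + 1) ⁻¹' {N (k + 1) x}))
    (hβ1 : β < 1)
    (hβ : ∀ k x E, MeasurableSet E → E ⊆ N k ⁻¹' {N k x} → 2 * μ E ≤ μ (N k ⁻¹' {N k x}) →
      ν E ≤ β * ν (N k ⁻¹' {N k x}))
    (hdiff : ∀ᵐ x ∂μ, ∀ t, (∀ k, ν (N k ⁻¹' {N k x}) ≤ t * μ (N k ⁻¹' {N k x})) → g x ≤ t) :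
    ∃ ε : ℝ, 0 < ε ∧ ∫⁻ x, g x ^ (1 + ε) ∂μ < ⊤ := by
  set B := 2 * A with hBdef
  have hB : 1 ≤ B := hA.trans (le_mul_of_one_le_left (by simp) (by norm_num))
  have hB' : B ≠ ⊤ := ENNReal.mul_ne_top (by simp) hA'
  obtain ⟨ε, hε, hεβ⟩ : ∃ ε : ℝ, 0 < ε ∧ B ^ ε * β < 1 := by
    have hb : 0 < B.toReal := ENNReal.toReal_pos (one_pos.trans_le hB).ne' hB'
    have hcont : Filter.Tendsto (fun ε : ℝ => B.toReal ^ ε * β.toReal) (nhdsWithin 0 (Set.Ioi 0))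
        (nhds (B.toReal ^ (0 : ℝ) * β.toReal)) :=
      (((Real.continuous_const_rpow hb.ne').mul continuous_const).tendsto 0).mono_left
        nhdsWithin_le_nhds
    have hlt : B.toReal ^ (0 : ℝ) * β.toReal < 1 := by
      rw [Real.rpow_zero, one_mul]
      simpa using (ENNReal.toReal_lt_toReal hβ1.ne_top one_ne_top).2 hβ1
    obtain ⟨ε, h1, h2⟩ := ((hcont.eventually (gt_mem_nhds hlt)).and self_mem_nhdsWithin).exists
    refine ⟨ε, h2, ?_⟩
    have h3 : B ^ ε * β ≠ ⊤ :=
      ENNReal.mul_ne_top (ENNReal.rpow_ne_top_of_nonneg (le_of_lt h2) hB') hβ1.ne_top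
    rw [← ENNReal.toReal_lt_toReal h3 one_ne_top]
    simpa [ENNReal.toReal_mul, ENNReal.toReal_rpow] using h1
  refine ⟨ε, hε, ?_⟩
  let Ω : ℕ → Set X := fun m =>
    {x | ∃ k, l * B ^ m * μ (N k ⁻¹' {N k x}) < ν (N k ⁻¹' {N k x})}
  have hΩm (m) : MeasurableSet (Ω m) := by
    have : Ω m = ⋃ k, ⋃ i, ⋃ (_ : l * B ^ m * μ (N k ⁻¹' {i}) < ν (N k ⁻¹' {i})),
        N k ⁻¹' {i} := by
      ext x
      simp [Ω]
    rw [this]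
    exact MeasurableSet.iUnion fun k => MeasurableSet.iUnion fun i =>
      MeasurableSet.iUnion fun _ => hN k i
  have hdecay (m) : ν (Ω m) ≤ β ^ m * ν Set.univ := by
    induction m with
    | zero => simpa using measure_mono (Set.subset_univ _)
    | succ m ih =>
      have := measure_level_le (t := l * B ^ m) hN href h0 hl hA hA' hdoub hβ
        (le_mul_of_one_le_right (by simp) (one_le_pow₀ hB))
        (ENNReal.mul_ne_top hl' (ENNReal.pow_ne_top hB'))
      have e : 2 * A * (l * B ^ m) = l * B ^ (m + 1) := by rw [← hBdef]; ring
      rw [e] at this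
      calc ν (Ω (m + 1)) ≤ β * ν (Ω m) := this
        _ ≤ β * (β ^ m * ν Set.univ) := by gcongr
        _ = _ := by ring
  have hac : ν ≪ μ := hν ▸ withDensity_absolutelyContinuous μ g
  have key := lintegral_rpow_le_tsum ν (h := g) hl hB hε hΩm (hac.ae_le (by
    filter_upwards [hdiff] with x hx k hk
    refine hx _ fun j => ?_
    by_contra hc
    exact hk ⟨j, not_le.1 hc⟩))
  have hint : ∫⁻ x, g x ^ (1 + ε) ∂μ = ∫⁻ x, g x ^ ε ∂ν := by
    rw [hν, lintegral_withDensity_eq_lintegral_mul _ hg (hg.pow_const ε)]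
    refine lintegral_congr fun x => ?_
    simp [ENNReal.rpow_add_of_nonneg _ _ zero_le_one hε.le]
  rw [hint]
  refine key.trans_lt (ENNReal.mul_lt_top (ENNReal.rpow_lt_top_of_nonneg hε.le hl')
    (ENNReal.add_lt_top.2 ⟨hfin.lt_top, ?_⟩))
  calc ∑' k, (B ^ ε) ^ (k + 1) * ν (Ω k)
      ≤ ∑' k, B ^ ε * ν Set.univ * (B ^ ε * β) ^ k := by
        refine ENNReal.tsum_le_tsum fun k => ?_
        calc (B ^ ε) ^ (k + 1) * ν (Ω k) ≤ (B ^ ε) ^ (k + 1) * (β ^ k * ν Set.univ) := by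
              gcongr; exact hdecay k
          _ = _ := by ring
    _ = B ^ ε * ν Set.univ * (1 - B ^ ε * β)⁻¹ := by
        rw [ENNReal.tsum_mul_left, ENNReal.tsum_geometric]
    _ < ⊤ := by
        refine ENNReal.mul_lt_top (ENNReal.mul_lt_top
          (ENNReal.rpow_lt_top_of_nonneg hε.le hB') hfin.lt_top) ?_
        simpa using hεβ

section MaximalFunction

open Metric

variable {n : ℕ}

lemma volume_closedBall_mul (x y : Fin n → ℝ) {c r : ℝ} (hc : 0 ≤ c) (hr : 0 ≤ r) :
    volume (closedBall x (c * r)) = ENNReal.ofReal c ^ n * volume (closedBall y r) := by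
  rw [Real.volume_pi_closedBall _ (mul_nonneg hc hr), Real.volume_pi_closedBall _ hr,
    ← ENNReal.ofReal_pow hc, ← ENNReal.ofReal_mul (by positivity), Fintype.card_fin]
  congr 1
  ring

lemma volume_closedBall_ne_zero (x : Fin n → ℝ) {r : ℝ} (hr : 0 < r) :
    volume (closedBall x r) ≠ 0 :=
  (measure_closedBall_pos _ _ hr).ne'

lemma volume_closedBall_ne_top (x : Fin n → ℝ) (r : ℝ) : volume (closedBall x r) ≠ ⊤ :=
  measure_closedBall_lt_top.ne

/-- Lebesgue differentiation along shrinking cubes, as an upper bound. -/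
lemma ae_le_of_forall_lintegral_closedBall_le {g : (Fin n → ℝ) → ℝ≥0∞} (hg : Measurable g)
    (hfin : ∫⁻ x, g x ≠ ⊤) :
    ∀ᵐ x, ∀ (c : ℕ → Fin n → ℝ) (r : ℕ → ℝ),
      Filter.Tendsto r Filter.atTop (nhdsWithin 0 (Set.Ioi 0)) →
      (∀ j, x ∈ closedBall (c j) (r j)) → ∀ t,
      (∀ j, ∫⁻ y in closedBall (c j) (r j), g y ≤ t * volume (closedBall (c j) (r j))) →
      g x ≤ t := by
  have hint : Integrable (fun x => (g x).toReal) :=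
    integrable_toReal_of_lintegral_ne_top hg.aemeasurable hfin
  filter_upwards [IsUnifLocDoublingMeasure.ae_tendsto_average volume hint.locallyIntegrable 1,
    ae_lt_top hg hfin] with x hx hxt c r hr hmem t ht
  rcases eq_or_ne t ⊤ with rfl | htt
  · exact le_top
  have hlim := hx c r hr (Filter.Eventually.of_forall fun j => by simpa using hmem j)
  rw [← ENNReal.ofReal_toReal hxt.ne, ENNReal.ofReal_le_iff_le_toReal htt]
  refine le_of_tendsto hlim ?_
  filter_upwards [hr self_mem_nhdsWithin] with j hj
  have hj' : 0 < r j := hj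
  rw [setAverage_eq, integral_toReal hg.aemeasurable
    (ae_restrict_of_ae (ae_lt_top hg hfin)), smul_eq_mul, Measure.real]
  have hV : 0 < (volume (closedBall (c j) (r j))).toReal :=
    ENNReal.toReal_pos (volume_closedBall_ne_zero _ hj') (volume_closedBall_ne_top _ _)
  rw [inv_mul_le_iff₀ hV, mul_comm, ← ENNReal.toReal_mul]
  exact ENNReal.toReal_mono (ENNReal.mul_ne_top htt (volume_closedBall_ne_top _ _)) (ht j)

/-- The centred maximal function over cubes of dyadic radius. -/
noncomputable def centredMaximal (g : (Fin n → ℝ) → ℝ≥0∞) (x : Fin n → ℝ) : ℝ≥0∞ :=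
  ⨆ k : ℤ, (∫⁻ y in closedBall x ((2 : ℝ) ^ k), g y) / volume (closedBall x ((2 : ℝ) ^ k))

lemma lt_centredMaximal_iff {g : (Fin n → ℝ) → ℝ≥0∞} {x : Fin n → ℝ} {t : ℝ≥0∞} :
    t < centredMaximal g x ↔ ∃ k : ℤ, t * volume (closedBall x ((2 : ℝ) ^ k)) <
      ∫⁻ y in closedBall x ((2 : ℝ) ^ k), g y := by
  rw [centredMaximal, lt_iSup_iff]
  refine exists_congr fun k => ?_
  rw [ENNReal.lt_div_iff_mul_lt (Or.inl (volume_closedBall_ne_zero _ (by positivity)))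
    (Or.inl (volume_closedBall_ne_top _ _))]

lemma lintegral_closedBall_le_centredMaximal (g : (Fin n → ℝ) → ℝ≥0∞) (x : Fin n → ℝ) (k : ℤ) :
    ∫⁻ y in closedBall x ((2 : ℝ) ^ k), g y ≤
      centredMaximal g x * volume (closedBall x ((2 : ℝ) ^ k)) := by
  by_contra h
  exact lt_irrefl _ (lt_centredMaximal_iff.2 ⟨k, not_le.1 h⟩)

lemma measurable_centredMaximal {g : (Fin n → ℝ) → ℝ≥0∞} (hg : Measurable g) :
    Measurable (centredMaximal g) := by
  refine Measurable.iSup fun k => Measurable.div ?_ ?_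
  · have h : Measurable (Function.uncurry fun x y : Fin n → ℝ =>
        (closedBall x ((2 : ℝ) ^ k)).indicator g y) := by
      have hs : MeasurableSet {p : (Fin n → ℝ) × (Fin n → ℝ) | dist p.2 p.1 ≤ (2 : ℝ) ^ k} :=
        measurableSet_le (measurable_snd.dist measurable_fst) measurable_const
      exact (hg.comp measurable_snd).indicator hs
    simp_rw [← lintegral_indicator measurableSet_closedBall]
    exact h.lintegral_prod_right'
  · have : (fun x : Fin n → ℝ => volume (closedBall x ((2 : ℝ) ^ k))) =
        fun _ => volume (closedBall (0 : Fin n → ℝ) ((2 : ℝ) ^ k)) := by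
      funext x
      simpa using volume_closedBall_mul x 0 zero_le_one (by positivity : (0 : ℝ) ≤ 2 ^ k)
    rw [this]
    exact measurable_const

/-- The weak type `(1, 1)` inequality. -/
lemma mul_volume_lt_centredMaximal_le (g : (Fin n → ℝ) → ℝ≥0∞) (t : ℝ≥0∞) :
    t * volume {x | t < centredMaximal g x} ≤ 5 ^ n * ∫⁻ x, g x := by
  let S : ℕ → Set (Fin n → ℝ) := fun K => {x | ∃ k : ℤ, k ≤ K ∧
    t * volume (closedBall x ((2 : ℝ) ^ k)) < ∫⁻ y in closedBall x ((2 : ℝ) ^ k), g y}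
  have hS : {x | t < centredMaximal g x} = ⋃ K, S K := by
    ext x
    simp only [Set.mem_ofPred_eq, lt_centredMaximal_iff, Set.mem_iUnion, S]
    constructor
    · rintro ⟨k, hk⟩
      exact ⟨k.toNat, k, Int.self_le_toNat k, hk⟩
    · rintro ⟨_, k, _, hk⟩
      exact ⟨k, hk⟩
  have hmono : Monotone S := by
    rintro K K' hK x ⟨k, hk, h⟩
    exact ⟨k, hk.trans (by exact_mod_cast hK), h⟩
  rw [hS, hmono.measure_iUnion, ENNReal.mul_iSup]
  refine iSup_le fun K => ?_
  let T : Set ((Fin n → ℝ) × ℤ) := {p | p.2 ≤ K ∧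
    t * volume (closedBall p.1 ((2 : ℝ) ^ p.2)) < ∫⁻ y in closedBall p.1 ((2 : ℝ) ^ p.2), g y}
  obtain ⟨u, huT, hdisj, hcov⟩ := Vitali.exists_disjoint_subfamily_covering_enlargement_closedBall
    T (fun p => p.1) (fun p => (2 : ℝ) ^ p.2) ((2 : ℝ) ^ (K : ℤ))
    (fun p hp => zpow_le_zpow_right₀ one_le_two hp.1) 5 (by norm_num)
  have hu : u.Countable := hdisj.countable_of_nonempty_interior fun p _ =>
    (nonempty_ball.2 (by positivity : (0 : ℝ) < 2 ^ p.2)).mono ball_subset_interior_closedBall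
  have hsub : S K ⊆ ⋃ p ∈ u, closedBall p.1 (5 * (2 : ℝ) ^ p.2) := by
    rintro x ⟨k, hk, h⟩
    obtain ⟨b, hb, hsub⟩ := hcov (x, k) ⟨hk, h⟩
    exact Set.mem_biUnion hb (hsub (mem_closedBall_self (by positivity)))
  calc t * volume (S K)
      ≤ t * ∑' p : u, volume (closedBall p.1.1 (5 * (2 : ℝ) ^ p.1.2)) := by
        gcongr
        exact (measure_mono hsub).trans (measure_biUnion_le _ hu _)
    _ = ∑' p : u, 5 ^ n * (t * volume (closedBall p.1.1 ((2 : ℝ) ^ p.1.2))) := by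
        rw [← ENNReal.tsum_mul_left]
        refine tsum_congr fun p => ?_
        rw [volume_closedBall_mul p.1.1 p.1.1 (by norm_num) (by positivity)]
        rw [show ENNReal.ofReal 5 = 5 by simp]
        ring
    _ ≤ ∑' p : u, 5 ^ n * ∫⁻ y in closedBall p.1.1 ((2 : ℝ) ^ p.1.2), g y := by
        refine ENNReal.tsum_le_tsum fun p => ?_
        gcongr
        exact (huT p.2).2.le
    _ = 5 ^ n * ∫⁻ y in ⋃ p ∈ u, closedBall p.1 ((2 : ℝ) ^ p.2), g y := by
        rw [ENNReal.tsum_mul_left,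
          lintegral_biUnion hu (fun p _ => measurableSet_closedBall) hdisj]
    _ ≤ 5 ^ n * ∫⁻ x, g x := by
        gcongr
        exact Measure.restrict_le_self

lemma ae_centredMaximal_lt_top {g : (Fin n → ℝ) → ℝ≥0∞}
    (hfin : ∫⁻ x, g x ≠ ⊤) : ∀ᵐ x, centredMaximal g x < ⊤ := by
  have hC : 5 ^ n * ∫⁻ x, g x ≠ ⊤ := ENNReal.mul_ne_top (by simp) hfin
  rw [ae_iff]
  by_contra h0
  have hle (t : ℝ≥0∞) (ht : t ≠ ⊤) : t * volume {x | ¬ centredMaximal g x < ⊤} ≤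
      5 ^ n * ∫⁻ x, g x := by
    refine le_trans ?_ (mul_volume_lt_centredMaximal_le g t)
    gcongr with x
    intro hx
    exact ht.lt_top.trans_le (not_lt.1 hx)
  obtain ⟨m, hm⟩ := ENNReal.exists_nat_mul_gt h0 hC
  exact absurd (hle m (by simp)) (not_le.2 hm)

lemma ae_le_centredMaximal {g : (Fin n → ℝ) → ℝ≥0∞} (hg : Measurable g)
    (hfin : ∫⁻ x, g x ≠ ⊤) : ∀ᵐ x, g x ≤ centredMaximal g x := by
  filter_upwards [ae_le_of_forall_lintegral_closedBall_le hg hfin] with x hx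
  refine hx (fun _ => x) (fun j => (2 : ℝ) ^ (-(j : ℤ))) ?_
    (fun j => mem_closedBall_self (by positivity)) _
    (fun j => lintegral_closedBall_le_centredMaximal g x _)
  refine tendsto_nhdsWithin_iff.2 ⟨?_, Filter.Eventually.of_forall fun j => ?_⟩
  · simpa using tendsto_pow_atTop_nhds_zero_of_lt_one (r := (1 / 2 : ℝ)) (by norm_num)
      (by norm_num)
  · exact Set.mem_Ioi.2 (by positivity)

/-- The constant in the `A₁` estimate for powers of the maximal function. -/
noncomputable def powMaximalConst (n : ℕ) (δ : ℝ) : ℝ≥0∞ :=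
  (2 ^ n) ^ δ * (1 + 2 ^ δ * 40 ^ n * (1 - 2 ^ δ * 2⁻¹)⁻¹)

lemma powMaximalConst_ne_top (n : ℕ) {δ : ℝ} (hδ : 0 < δ) (hδ1 : δ < 1) :
    powMaximalConst n δ ≠ ⊤ := by
  have h1 : (2 : ℝ≥0∞) ^ δ * 2⁻¹ < 1 := by
    rw [← div_eq_mul_inv]
    refine ENNReal.div_lt_of_lt_mul ?_
    rw [one_mul]
    simpa using ENNReal.rpow_lt_rpow_of_exponent_lt (x := 2) (by norm_num) (by simp) hδ1
  refine ENNReal.mul_ne_top (ENNReal.rpow_ne_top_of_nonneg hδ.le (by simp))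
    (ENNReal.add_ne_top.2 ⟨by simp, ENNReal.mul_ne_top (ENNReal.mul_ne_top
      (ENNReal.rpow_ne_top_of_nonneg hδ.le (by simp)) (by simp)) ?_⟩)
  exact ENNReal.inv_ne_top.2 (tsub_pos_of_lt h1).ne'

lemma lintegral_closedBall_rpow_centredMaximal_le {g : (Fin n → ℝ) → ℝ≥0∞} (hg : Measurable g)
    {δ : ℝ} (hδ : 0 < δ) {c z : Fin n → ℝ} {r : ℝ} (hr : 0 < r)
    (hz : z ∈ closedBall c r) (hz0 : centredMaximal g z ≠ 0) (hzt : centredMaximal g z ≠ ⊤) :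
    ∫⁻ x in closedBall c r, centredMaximal g x ^ δ ≤
      powMaximalConst n δ * volume (closedBall c r) * centredMaximal g z ^ δ := by
  set R := closedBall c r with hR
  set m := 2 ^ n * centredMaximal g z with hm
  have hm0 : m ≠ 0 := mul_ne_zero (by simp) hz0
  have hmt : m ≠ ⊤ := ENNReal.mul_ne_top (by simp) hzt
  have hzm : centredMaximal g z ≤ m := le_mul_of_one_le_left (by simp) (one_le_pow₀ (by norm_num))
  let Ω : ℕ → Set (Fin n → ℝ) := fun k => {x | m * 2 ^ k < centredMaximal g x}
  have hΩm (k) : MeasurableSet (Ω k) :=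
    measurableSet_lt measurable_const (measurable_centredMaximal hg)
  set g' := (closedBall c (3 * r)).indicator g with hg'
  have hlocal (s : ℝ≥0∞) (hs : m ≤ s) (x) (hx : x ∈ R) (hxs : s < centredMaximal g x) :
      s < centredMaximal g' x := by
    rw [lt_centredMaximal_iff] at hxs ⊢
    obtain ⟨k, hk⟩ := hxs
    refine ⟨k, ?_⟩
    have hxz : dist x z ≤ 2 * r := by
      have := dist_triangle_right x z c
      rw [hR, mem_closedBall] at hx
      rw [mem_closedBall] at hz
      linarith
    rcases le_or_gt ((2 : ℝ) ^ k) (2 * r) with h | h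
    · have hsub : closedBall x ((2 : ℝ) ^ k) ⊆ closedBall c (3 * r) :=
        closedBall_subset_closedBall' (by rw [hR, mem_closedBall] at hx; linarith)
      have : ∫⁻ y in closedBall x ((2 : ℝ) ^ k), g' y =
          ∫⁻ y in closedBall x ((2 : ℝ) ^ k), g y := by
        refine setLIntegral_congr_fun measurableSet_closedBall fun y hy => ?_
        simp [hg', hsub hy]
      rwa [this]
    · exfalso
      refine absurd hk (not_lt.2 ?_)
      have e : (2 : ℝ) ^ (k + 1) = 2 * 2 ^ k := by rw [zpow_add_one₀ two_ne_zero]; ring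
      calc ∫⁻ y in closedBall x ((2 : ℝ) ^ k), g y
          ≤ ∫⁻ y in closedBall z ((2 : ℝ) ^ (k + 1)), g y := by
            refine lintegral_mono_set (closedBall_subset_closedBall' ?_)
            rw [e]; linarith
        _ ≤ centredMaximal g z * volume (closedBall z ((2 : ℝ) ^ (k + 1))) :=
            lintegral_closedBall_le_centredMaximal g z _
        _ = m * volume (closedBall x ((2 : ℝ) ^ k)) := by
            rw [e, volume_closedBall_mul z x (by norm_num) (by positivity), hm]
            rw [show ENNReal.ofReal 2 = 2 by simp]
            ring
        _ ≤ s * volume (closedBall x ((2 : ℝ) ^ k)) := by gcongr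
  have hmass : ∫⁻ x, g' x ≤ m * 8 ^ n * volume R := by
    obtain ⟨j, hj1, hj2⟩ := exists_mem_Ioc_zpow (by positivity : 0 < 4 * r) (one_lt_two (α := ℝ))
    have e : (2 : ℝ) ^ (j + 1) = 2 * 2 ^ j := by rw [zpow_add_one₀ two_ne_zero]; ring
    rw [mem_closedBall] at hz
    calc ∫⁻ x, g' x = ∫⁻ x in closedBall c (3 * r), g x :=
          lintegral_indicator measurableSet_closedBall _
      _ ≤ ∫⁻ x in closedBall z ((2 : ℝ) ^ (j + 1)), g x := by
          refine lintegral_mono_set (closedBall_subset_closedBall' ?_)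
          rw [dist_comm]
          linarith
      _ ≤ centredMaximal g z * volume (closedBall z ((2 : ℝ) ^ (j + 1))) :=
          lintegral_closedBall_le_centredMaximal g z _
      _ ≤ m * volume (closedBall z (8 * r)) := by
          gcongr
          rw [e]; linarith
      _ = m * 8 ^ n * volume R := by
          rw [volume_closedBall_mul z c (by norm_num) hr.le,
            show ENNReal.ofReal 8 = 8 by simp, ← hR]
          ring
  have hdecay (k : ℕ) : volume.restrict R (Ω k) ≤ 40 ^ n * volume R * 2⁻¹ ^ k := by
    have h1 : volume.restrict R (Ω k) ≤ volume {x | m * 2 ^ k < centredMaximal g' x} := by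
      rw [Measure.restrict_apply (hΩm k)]
      refine measure_mono ?_
      rintro x ⟨hx, hxR⟩
      exact hlocal _ (le_mul_of_one_le_right (by simp) (one_le_pow₀ (by norm_num))) x hxR hx
    have h2 : m * (2 ^ k * volume.restrict R (Ω k)) ≤ m * (40 ^ n * volume R) := by
      calc m * (2 ^ k * volume.restrict R (Ω k))
          ≤ m * (2 ^ k * volume {x | m * 2 ^ k < centredMaximal g' x}) := by gcongr
        _ = m * 2 ^ k * volume {x | m * 2 ^ k < centredMaximal g' x} := by ring
        _ ≤ 5 ^ n * ∫⁻ x, g' x := mul_volume_lt_centredMaximal_le g' _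
        _ ≤ 5 ^ n * (m * 8 ^ n * volume R) := by gcongr
        _ = m * ((5 * 8) ^ n * volume R) := by rw [mul_pow]; ring
        _ = _ := by norm_num
    rw [ENNReal.mul_le_mul_iff_right hm0 hmt] at h2
    rw [← ENNReal.inv_pow, ← div_eq_mul_inv, ENNReal.le_div_iff_mul_le (by simp) (by simp),
      mul_comm]
    exact h2
  have key := lintegral_rpow_le_tsum (volume.restrict R) (h := centredMaximal g) (B := 2) hm0
    (by norm_num) hδ hΩm (Filter.Eventually.of_forall fun x k hk => not_lt.1 hk)
  refine key.trans ?_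
  calc m ^ δ * (volume.restrict R Set.univ + ∑' k, (2 ^ δ) ^ (k + 1) * volume.restrict R (Ω k))
      ≤ m ^ δ * (volume R + ∑' k : ℕ, 2 ^ δ * 40 ^ n * volume R * (2 ^ δ * 2⁻¹) ^ k) := by
        refine mul_le_mul_right (add_le_add ?_ (ENNReal.tsum_le_tsum fun k => ?_)) _
        · simp
        · calc ((2 : ℝ≥0∞) ^ δ) ^ (k + 1) * volume.restrict R (Ω k)
              ≤ (2 ^ δ) ^ (k + 1) * (40 ^ n * volume R * 2⁻¹ ^ k) := by gcongr; exact hdecay k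
            _ = _ := by ring
    _ = powMaximalConst n δ * volume R * centredMaximal g z ^ δ := by
        rw [ENNReal.tsum_mul_left, ENNReal.tsum_geometric, hm,
          ENNReal.mul_rpow_of_nonneg _ _ hδ.le, powMaximalConst]
        ring

end MaximalFunction

section DyadicCubes

open Metric

variable {n : ℕ}

/-- Index of the dyadic subcube of generation `k` of the cube of centre `c` and radius `r`
containing `x`. -/
noncomputable def dyadicIndex (c : Fin n → ℝ) (r : ℝ) (k : ℕ) (x : Fin n → ℝ) : Fin n → ℤ :=
  fun i => ⌊2 ^ k * ((x i - (c i - r)) / (2 * r))⌋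

/-- Centre of the dyadic subcube of generation `k` with index `m`. -/
noncomputable def dyadicCentre (c : Fin n → ℝ) (r : ℝ) (k : ℕ) (m : Fin n → ℤ) : Fin n → ℝ :=
  fun i => c i - r + (2 * m i + 1) * (r / 2 ^ k)

lemma dyadicIndex_fibre (c : Fin n → ℝ) {r : ℝ} (hr : 0 < r) (k : ℕ) (m : Fin n → ℤ) :
    dyadicIndex c r k ⁻¹' {m} = Set.univ.pi fun i =>
      Set.Ico (dyadicCentre c r k m i - r / 2 ^ k) (dyadicCentre c r k m i + r / 2 ^ k) := by
  ext x
  simp only [Set.mem_preimage, Set.mem_singleton_iff, funext_iff, Set.mem_pi, Set.mem_univ,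
    true_implies, Set.mem_Ico, dyadicIndex, Int.floor_eq_iff, dyadicCentre]
  refine forall_congr' fun i => ?_
  have h2 : (0 : ℝ) < 2 ^ k := by positivity
  have e : x i - (c i - r) = 2 ^ k * ((x i - (c i - r)) / (2 * r)) * (2 * (r / 2 ^ k)) := by
    field_simp
  have hρ : 0 < r / 2 ^ k := by positivity
  set ρ := r / 2 ^ k
  set y := 2 ^ k * ((x i - (c i - r)) / (2 * r))
  constructor
  · rintro ⟨h1, h2⟩
    constructor <;> nlinarith
  · rintro ⟨h1, h2⟩
    constructor
    · by_contra hc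
      nlinarith
    · by_contra hc
      nlinarith

lemma measurableSet_dyadicIndex_fibre (c : Fin n → ℝ) {r : ℝ} (hr : 0 < r) (k : ℕ)
    (m : Fin n → ℤ) : MeasurableSet (dyadicIndex c r k ⁻¹' {m}) := by
  rw [dyadicIndex_fibre c hr]
  exact MeasurableSet.univ_pi fun i => measurableSet_Ico

lemma closedBall_dyadicCentre (c : Fin n → ℝ) {r : ℝ} (hr : 0 < r) (k : ℕ) (m : Fin n → ℤ) :
    closedBall (dyadicCentre c r k m) (r / 2 ^ k) = Set.univ.pi fun i =>
      Set.Icc (dyadicCentre c r k m i - r / 2 ^ k) (dyadicCentre c r k m i + r / 2 ^ k) := by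
  rw [closedBall_pi _ (by positivity)]
  simp [Real.closedBall_eq_Icc]

lemma dyadicIndex_fibre_subset (c : Fin n → ℝ) {r : ℝ} (hr : 0 < r) (k : ℕ) (m : Fin n → ℤ) :
    dyadicIndex c r k ⁻¹' {m} ⊆ closedBall (dyadicCentre c r k m) (r / 2 ^ k) := by
  rw [dyadicIndex_fibre c hr, closedBall_dyadicCentre c hr]
  exact Set.pi_mono fun i _ => Set.Ico_subset_Icc_self

lemma dyadicIndex_fibre_ae_eq (c : Fin n → ℝ) {r : ℝ} (hr : 0 < r) (k : ℕ) (m : Fin n → ℤ) :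
    dyadicIndex c r k ⁻¹' {m} =ᵐ[volume] closedBall (dyadicCentre c r k m) (r / 2 ^ k) := by
  rw [dyadicIndex_fibre c hr, closedBall_dyadicCentre c hr, Set.pi_univ_Icc]
  exact Measure.univ_pi_Ico_ae_eq_Icc

lemma dyadicIndex_refines (c : Fin n → ℝ) (r : ℝ) (j k : ℕ) (x y : Fin n → ℝ) (hjk : j ≤ k)
    (h : dyadicIndex c r k x = dyadicIndex c r k y) :
    dyadicIndex c r j x = dyadicIndex c r j y := by
  obtain ⟨d, rfl⟩ := Nat.exists_eq_add_of_le hjk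
  funext i
  have hi := congrFun h i
  have key (u : ℝ) : ⌊2 ^ j * u⌋ = ⌊2 ^ (j + d) * u⌋ / ((2 ^ d : ℕ) : ℤ) := by
    rw [← Int.floor_div_natCast]
    congr 1
    push_cast
    rw [pow_add]
    field_simp
  simp only [dyadicIndex] at hi ⊢
  rw [key, key, hi]

lemma dyadicCentre_zero (c : Fin n → ℝ) (r : ℝ) : dyadicCentre c r 0 0 = c := by
  funext i
  simp [dyadicCentre]

lemma closedBall_dyadicCentre_subset (c : Fin n → ℝ) {r : ℝ} (hr : 0 < r) (k : ℕ)
    (x : Fin n → ℝ) (hx : dyadicIndex c r 0 x = 0) :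
    closedBall (dyadicCentre c r k (dyadicIndex c r k x)) (r / 2 ^ k) ⊆ closedBall c r := by
  refine closedBall_subset_closedBall' ?_
  have hρ : 0 < r / 2 ^ k := by positivity
  have h2k : (1 : ℝ) ≤ 2 ^ k := one_le_pow₀ one_le_two
  have hle : r / 2 ^ k ≤ r := div_le_self hr.le h2k
  suffices dist (dyadicCentre c r k (dyadicIndex c r k x)) c ≤ r - r / 2 ^ k by linarith
  refine (dist_pi_le_iff (by linarith)).2 fun i => ?_
  have hi : ⌊(x i - (c i - r)) / (2 * r)⌋ = 0 := by simpa [dyadicIndex] using congrFun hx i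
  rw [Int.floor_eq_zero_iff] at hi
  have hm0 : (0 : ℤ) ≤ dyadicIndex c r k x i :=
    Int.floor_nonneg.2 (mul_nonneg (by positivity) hi.1)
  have hm1 : dyadicIndex c r k x i < 2 ^ k := by
    rw [dyadicIndex, Int.floor_lt]
    push_cast
    nlinarith [hi.2]
  have hm1' : dyadicIndex c r k x i + 1 ≤ 2 ^ k := hm1
  have hm0R : (0 : ℝ) ≤ dyadicIndex c r k x i := by exact_mod_cast hm0
  have hm1R : (dyadicIndex c r k x i : ℝ) + 1 ≤ 2 ^ k := by exact_mod_cast hm1'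
  have e : r = 2 ^ k * (r / 2 ^ k) := by field_simp
  rw [Real.dist_eq, dyadicCentre, abs_le]
  set ρ := r / 2 ^ k
  constructor
  · nlinarith
  · nlinarith

/-- Reverse Hölder self-improvement on a cube: if every measurable part containing at least half
of a subcube carries a fixed proportion of the mass of that subcube, then the density is integrable
to some power larger than one. -/
theorem exists_lintegral_rpow_closedBall_lt_top {c : Fin n → ℝ} {r : ℝ} (hr : 0 < r)
    {g : (Fin n → ℝ) → ℝ≥0∞} (hg : Measurable g) (hfin : ∫⁻ x in closedBall c r, g x ≠ ⊤)
    {K : ℝ≥0∞} (hK : K ≠ ⊤)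
    (hcond : ∀ c' r', 0 < r' → closedBall c' r' ⊆ closedBall c r → ∀ F, MeasurableSet F →
      F ⊆ closedBall c' r' → volume (closedBall c' r') ≤ 2 * volume F →
      ∫⁻ x in closedBall c' r', g x ≤ K * ∫⁻ x in F, g x) :
    ∃ ε : ℝ, 0 < ε ∧ ∫⁻ x in closedBall c r, g x ^ (1 + ε) < ⊤ := by
  set N := dyadicIndex c r with hNdef
  have hN := measurableSet_dyadicIndex_fibre c hr
  have href := dyadicIndex_refines c r
  set Q' := N 0 ⁻¹' {0} with hQ'
  have hQm : MeasurableSet Q' := hN 0 0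
  have hQae : Q' =ᵐ[volume] closedBall c r := by
    simpa [dyadicCentre_zero] using dyadicIndex_fibre_ae_eq c hr 0 0
  have hμQ : volume.restrict Q' = volume.restrict (closedBall c r) :=
    Measure.restrict_congr_set hQae
  rw [← hμQ]
  rw [← hμQ] at hfin
  set μ := volume.restrict Q' with hμ
  set ν := μ.withDensity g with hν
  have hνuniv : ν Set.univ ≠ ⊤ := by
    rwa [hν, withDensity_apply _ MeasurableSet.univ, Measure.restrict_univ]
  have hsub (k x) (hx : x ∈ Q') : N k ⁻¹' {N k x} ⊆ Q' := by
    intro y hy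
    have : N 0 y = N 0 x := href 0 k y x (Nat.zero_le k) hy
    rw [hQ', Set.mem_preimage, this]
    exact hx
  have hμE (E) (hE : MeasurableSet E) (hEQ : E ⊆ Q') : μ E = volume E := by
    rw [hμ, Measure.restrict_apply hE, Set.inter_eq_left.2 hEQ]
  have hνE (E) (hE : MeasurableSet E) (hEQ : E ⊆ Q') : ν E = ∫⁻ x in E, g x := by
    rw [hν, withDensity_apply _ hE, hμ, Measure.restrict_restrict hE, Set.inter_eq_left.2 hEQ]
  have hout (k x) (hx : x ∉ Q') : μ (N k ⁻¹' {N k x}) = 0 := by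
    rw [hμ, Measure.restrict_apply (hN _ _)]
    convert measure_empty (μ := volume)
    refine Set.eq_empty_of_forall_notMem fun y hy => hx ?_
    have : N 0 y = N 0 x := href 0 k y x (Nat.zero_le k) hy.1
    rw [hQ', Set.mem_preimage, ← this]
    exact hy.2
  have hac : ν ≪ μ := withDensity_absolutelyContinuous μ g
  have hball (k x) (hx : x ∈ Q') : μ (N k ⁻¹' {N k x}) =
      volume (closedBall (dyadicCentre c r k (N k x)) (r / 2 ^ k)) := by
    rw [hμE _ (hN _ _) (hsub k x hx)]
    exact measure_congr (dyadicIndex_fibre_ae_eq c hr k _)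
  have hball' (k x) (hx : x ∈ Q') : ν (N k ⁻¹' {N k x}) =
      ∫⁻ y in closedBall (dyadicCentre c r k (N k x)) (r / 2 ^ k), g y := by
    rw [hνE _ (hN _ _) (hsub k x hx)]
    exact setLIntegral_congr (dyadicIndex_fibre_ae_eq c hr k _)
  have hV0 : volume (closedBall c r) ≠ 0 := volume_closedBall_ne_zero c hr
  have hVt : volume (closedBall c r) ≠ ⊤ := volume_closedBall_ne_top c r
  set k₁ : ℝ := K.toReal + 1 with hk₁
  have hk₁0 : 1 ≤ k₁ := by simp [hk₁]
  refine exists_lintegral_rpow_lt_top_of_partitions (N := N) (μ := μ) (ν := ν)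
    (l := max 1 (ν Set.univ / volume (closedBall c r))) (A := 2 ^ n)
    (β := ENNReal.ofReal (1 - 1 / k₁)) hN href hg rfl hνuniv ?_ (by simp)
    (max_lt (by simp) (ENNReal.div_lt_top hνuniv hV0)).ne (one_le_pow₀ (by norm_num)) (by simp)
    ?_ ?_ ?_ ?_
  · intro x
    by_cases hx : x ∈ Q'
    · have : μ (N 0 ⁻¹' {N 0 x}) = volume (closedBall c r) := by
        rw [hball 0 x hx, show N 0 x = 0 from hx, dyadicCentre_zero]
        simp
      rw [this]
      calc ν (N 0 ⁻¹' {N 0 x}) ≤ ν Set.univ := measure_mono (Set.subset_univ _)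
        _ = ν Set.univ / volume (closedBall c r) * volume (closedBall c r) :=
          (ENNReal.div_mul_cancel hV0 hVt).symm
        _ ≤ _ := by gcongr; exact le_max_right _ _
    · simp [hac (hout 0 x hx)]
  · intro k x
    by_cases hx : x ∈ Q'
    · rw [hball k x hx, hball (k + 1) x hx]
      rw [show r / 2 ^ k = 2 * (r / 2 ^ (k + 1)) by rw [pow_succ]; field_simp,
        volume_closedBall_mul _ (dyadicCentre c r (k + 1) (N (k + 1) x)) (by norm_num)
          (by positivity)]
      simp
    · simp [hout k x hx]
  · rw [ENNReal.ofReal_lt_one]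
    have : 0 < 1 / k₁ := by positivity
    linarith
  · intro k x E hE hED hE2
    by_cases hx : x ∈ Q'
    · set D := N k ⁻¹' {N k x} with hD
      have hDQ := hsub k x hx
      have hDm : MeasurableSet D := hN _ _
      have hFm : MeasurableSet (D \ E) := hDm.diff hE
      have hFQ : D \ E ⊆ Q' := Set.sdiff_subset.trans hDQ
      have hμadd : μ E + μ (D \ E) = μ D := by
        rw [measure_sdiff hED hE.nullMeasurableSet, add_tsub_cancel_of_le (measure_mono hED)]
        rw [hμE E hE (hED.trans hDQ)]
        refine ((measure_mono (hED.trans hDQ)).trans_lt ?_).ne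
        rw [measure_congr hQae]
        exact hVt.lt_top
      have hνEt : ν E ≠ ⊤ := ((measure_mono (Set.subset_univ _)).trans_lt hνuniv.lt_top).ne
      have hνFt : ν (D \ E) ≠ ⊤ :=
        ((measure_mono (Set.subset_univ _)).trans_lt hνuniv.lt_top).ne
      have hνadd : ν E + ν (D \ E) = ν D := by
        rw [measure_sdiff hED hE.nullMeasurableSet hνEt,
          add_tsub_cancel_of_le (measure_mono hED)]
      have hμDt : μ D ≠ ⊤ := by
        rw [hball k x hx]; exact volume_closedBall_ne_top _ _
      have hhalf : μ D ≤ 2 * μ (D \ E) := by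
        have : μ D + μ D ≤ μ D + 2 * μ (D \ E) := by
          calc μ D + μ D = 2 * μ E + 2 * μ (D \ E) := by rw [← hμadd]; ring
            _ ≤ _ := by gcongr
        exact (ENNReal.add_le_add_iff_left hμDt).1 this
      have hmass : ν D ≤ K * ν (D \ E) := by
        rw [hball k x hx, hμE _ hFm hFQ] at hhalf
        rw [hball' k x hx, hνE _ hFm hFQ]
        exact hcond _ _ (by positivity) (closedBall_dyadicCentre_subset c hr k x hx) _ hFm
          (Set.sdiff_subset.trans (dyadicIndex_fibre_subset c hr k _)) hhalf
      rw [← hνadd] at hmass ⊢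
      rw [← ENNReal.ofReal_toReal hνEt, ← ENNReal.ofReal_toReal hνFt,
        ← ENNReal.ofReal_add (by positivity) (by positivity)] at hmass ⊢
      rw [← ENNReal.ofReal_toReal hK, ← ENNReal.ofReal_mul (by positivity),
        ENNReal.ofReal_le_ofReal_iff (by positivity)] at hmass
      rw [← ENNReal.ofReal_mul (by simpa using inv_le_one_of_one_le₀ hk₁0)]
      refine ENNReal.ofReal_le_ofReal ?_
      have hE0 : 0 ≤ (ν E).toReal := by positivity
      have hF0 : 0 ≤ (ν (D \ E)).toReal := by positivity
      have hk₁pos : 0 < k₁ := by linarith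
      have e : (1 - 1 / k₁) * ((ν E).toReal + (ν (D \ E)).toReal) =
          (ν E).toReal + (k₁ * (ν (D \ E)).toReal - ((ν E).toReal + (ν (D \ E)).toReal)) / k₁ := by
        field_simp
        ring
      rw [e]
      have : 0 ≤ (k₁ * (ν (D \ E)).toReal - ((ν E).toReal + (ν (D \ E)).toReal)) / k₁ := by
        apply div_nonneg _ hk₁pos.le
        rw [hk₁]
        linarith
      linarith
    · simp [hac (measure_mono_null hED (hout k x hx))]
  · have hind : ∫⁻ x, (closedBall c r).indicator g x ≠ ⊤ := by
      rwa [lintegral_indicator measurableSet_closedBall, ← hμQ]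
    have hae := ae_le_of_forall_lintegral_closedBall_le
      (hg.indicator measurableSet_closedBall) hind
    filter_upwards [ae_restrict_of_ae hae, ae_restrict_mem hQm] with x hx hxQ t ht
    have hxB : x ∈ closedBall c r := by
      simpa [dyadicCentre_zero] using dyadicIndex_fibre_subset c hr 0 0 hxQ
    have := hx (fun k => dyadicCentre c r k (N k x)) (fun k => r / 2 ^ k) ?_ ?_ t ?_
    · simpa [hxB] using this
    · refine tendsto_nhdsWithin_iff.2 ⟨?_, Filter.Eventually.of_forall fun j => ?_⟩
      · exact tendsto_const_nhds.div_atTop (tendsto_pow_atTop_atTop_of_one_lt one_lt_two)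
      · exact Set.mem_Ioi.2 (by positivity)
    · intro k
      exact dyadicIndex_fibre_subset c hr k _ rfl
    · intro k
      have h1 := ht k
      rw [hball k x hxQ, hball' k x hxQ] at h1
      refine le_trans (le_of_eq ?_) h1
      refine setLIntegral_congr_fun measurableSet_closedBall fun y hy => ?_
      simp [closedBall_dyadicCentre_subset c hr k x hxQ hy]

end DyadicCubes

section Cubes

open Metric

variable {n : ℕ}

lemma isCube_iff {Q : Set (Fin n → ℝ)} :
    IsCube Q ↔ ∃ (c : Fin n → ℝ) (r : ℝ), 0 < r ∧ Q = closedBall c r := by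
  constructor
  · rintro ⟨a, l, hl, rfl⟩
    refine ⟨fun i => a i + l / 2, l / 2, by positivity, ?_⟩
    rw [closedBall_pi _ (by positivity)]
    congr 1
    funext i
    rw [Real.closedBall_eq_Icc]
    congr 1 <;> ring
  · rintro ⟨c, r, hr, rfl⟩
    refine ⟨fun i => c i - r, 2 * r, by positivity, ?_⟩
    rw [closedBall_pi _ hr.le]
    congr 1
    funext i
    rw [Real.closedBall_eq_Icc]
    congr 1
    ring

lemma IsCube.measurableSet {Q : Set (Fin n → ℝ)} (hQ : IsCube Q) : MeasurableSet Q := by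
  obtain ⟨c, r, -, rfl⟩ := isCube_iff.1 hQ
  exact measurableSet_closedBall

lemma IsCube.volume_ne_zero {Q : Set (Fin n → ℝ)} (hQ : IsCube Q) : volume Q ≠ 0 := by
  obtain ⟨c, r, hr, rfl⟩ := isCube_iff.1 hQ
  exact volume_closedBall_ne_zero c hr

lemma IsCube.volume_ne_top {Q : Set (Fin n → ℝ)} (hQ : IsCube Q) : volume Q ≠ ⊤ := by
  obtain ⟨c, r, hr, rfl⟩ := isCube_iff.1 hQ
  exact volume_closedBall_ne_top c r

lemma IsCube.exists_lintegral_rpow_lt_top {Q : Set (Fin n → ℝ)} (hQ : IsCube Q)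
    {g : (Fin n → ℝ) → ℝ≥0∞} (hg : Measurable g) (hfin : ∫⁻ x in Q, g x ≠ ⊤)
    {K : ℝ≥0∞} (hK : K ≠ ⊤)
    (hcond : ∀ R, IsCube R → R ⊆ Q → ∀ F, MeasurableSet F → F ⊆ R →
      volume R ≤ 2 * volume F → ∫⁻ x in R, g x ≤ K * ∫⁻ x in F, g x) :
    ∃ ε : ℝ, 0 < ε ∧ ∫⁻ x in Q, g x ^ (1 + ε) < ⊤ := by
  obtain ⟨c, r, hr, rfl⟩ := isCube_iff.1 hQ
  exact exists_lintegral_rpow_closedBall_lt_top hr hg hfin hK fun c' r' hr' =>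
    hcond _ (isCube_iff.2 ⟨c', r', hr', rfl⟩)

lemma IsWeight.pos_on {Ω R : Set (Fin n → ℝ)} {w : (Fin n → ℝ) → ℝ} (hw : IsWeight Ω w)
    (hR : R ⊆ Ω) : ∀ᵐ x ∂(volume.restrict R), 0 < w x :=
  ae_restrict_of_ae_restrict_of_subset hR hw.pos

lemma IsWeight.lintegral_ne_top {Ω R : Set (Fin n → ℝ)} {w : (Fin n → ℝ) → ℝ} (hw : IsWeight Ω w)
    (hR : IsCube R) (hRΩ : R ⊆ Ω) : ∫⁻ x in R, ENNReal.ofReal (w x) ≠ ⊤ :=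
  (hw.locInt R hR hRΩ).lintegral_lt_top.ne

lemma IsWeight.lintegral_ne_zero {Ω R : Set (Fin n → ℝ)} {w : (Fin n → ℝ) → ℝ}
    (hw : IsWeight Ω w) (hR : IsCube R) (hRΩ : R ⊆ Ω) :
    ∫⁻ x in R, ENNReal.ofReal (w x) ≠ 0 := by
  intro h
  rw [lintegral_eq_zero_iff hw.measurable.ennreal_ofReal] at h
  have : ∀ᵐ x ∂(volume.restrict R), False := by
    filter_upwards [h, hw.pos_on hRΩ] with x h1 h2
    exact absurd (ENNReal.ofReal_eq_zero.1 h1) (not_le.2 h2)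
  rw [ae_iff] at this
  exact hR.volume_ne_zero (by simpa using this)

/-- An `A₁` weight dominates its averages. -/
lemma MemA1.exists_average_le {Ω : Set (Fin n → ℝ)} {w : (Fin n → ℝ) → ℝ} (hw : MemA1 Ω w) :
    ∃ C : ℝ≥0∞, C ≠ ⊤ ∧ ∀ R, IsCube R → R ⊆ Ω → ∀ᵐ x ∂(volume.restrict R),
      (volume R)⁻¹ * ∫⁻ y in R, ENNReal.ofReal (w y) ≤ C * ENNReal.ofReal (w x) := by
  obtain ⟨hW, C, hC⟩ := hw
  refine ⟨ENNReal.ofReal C, by simp, fun R hR hRΩ => ?_⟩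
  filter_upwards [ae_restrict_of_ae_restrict_of_subset hRΩ hC, hW.pos_on hRΩ,
    ae_restrict_mem hR.measurableSet] with x hx hpos hxR
  rw [← ENNReal.ofReal_mul' hpos.le]
  refine le_trans ?_ hx
  rw [maximal]
  refine le_iSup_of_le R (le_iSup_of_le hR (le_iSup_of_le hRΩ (le_iSup_of_le hxR ?_)))
  gcongr
  exact le_abs_self _

lemma MemA1.exists_lintegral_rpow_lt_top {Q : Set (Fin n → ℝ)} (hQ : IsCube Q)
    {w : (Fin n → ℝ) → ℝ} (hw : MemA1 Q w) :
    ∃ ε : ℝ, 0 < ε ∧ ∫⁻ x in Q, ENNReal.ofReal (w x) ^ (1 + ε) < ⊤ := by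
  obtain ⟨C, hC, hav⟩ := hw.exists_average_le
  refine hQ.exists_lintegral_rpow_lt_top hw.1.measurable.ennreal_ofReal
    (hw.1.lintegral_ne_top hQ subset_rfl) (K := 2 * C) (ENNReal.mul_ne_top (by simp) hC) ?_
  intro R hR hRQ F hF hFR hvol
  have h1 : volume F * ((volume R)⁻¹ * ∫⁻ y in R, ENNReal.ofReal (w y)) ≤
      C * ∫⁻ x in F, ENNReal.ofReal (w x) := by
    rw [mul_comm (volume F), ← setLIntegral_const]
    exact (lintegral_mono_ae (ae_restrict_of_ae_restrict_of_subset hFR (hav R hR hRQ))).trans_eq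
      (lintegral_const_mul _ hw.1.measurable.ennreal_ofReal)
  calc ∫⁻ y in R, ENNReal.ofReal (w y)
      = volume R * ((volume R)⁻¹ * ∫⁻ y in R, ENNReal.ofReal (w y)) := by
        rw [← mul_assoc, ENNReal.mul_inv_cancel hR.volume_ne_zero hR.volume_ne_top, one_mul]
    _ ≤ 2 * volume F * ((volume R)⁻¹ * ∫⁻ y in R, ENNReal.ofReal (w y)) := by gcongr
    _ = 2 * (volume F * ((volume R)⁻¹ * ∫⁻ y in R, ENNReal.ofReal (w y))) := by ring
    _ ≤ 2 * (C * ∫⁻ x in F, ENNReal.ofReal (w x)) := by gcongr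
    _ = _ := by ring

/-- Negative powers of `A₁` weights are `A_p` weights. -/
lemma MemA1.memApGT1_rpow {Q : Set (Fin n → ℝ)} {w : (Fin n → ℝ) → ℝ}
    (hw : MemA1 Q w) {p : ℝ} (hp : 1 < p) : MemApGT1 Q p fun x => w x ^ (1 - p) := by
  obtain ⟨C, hC, hav⟩ := hw.exists_average_le
  have hp0 : 0 < p - 1 := by linarith
  have hnz (R) (hR : IsCube R) (hRQ : R ⊆ Q) :
      ((volume R)⁻¹ * ∫⁻ y in R, ENNReal.ofReal (w y)) ^ (p - 1) ≠ 0 :=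
    (ENNReal.rpow_pos (pos_iff_ne_zero.2 (mul_ne_zero
        (ENNReal.inv_ne_zero.2 hR.volume_ne_top) (hw.1.lintegral_ne_zero hR hRQ)))
        (ENNReal.mul_ne_top (ENNReal.inv_ne_top.2 hR.volume_ne_zero)
          (hw.1.lintegral_ne_top hR hRQ))).ne'
  have hnt (R) (hR : IsCube R) (hRQ : R ⊆ Q) :
      ((volume R)⁻¹ * ∫⁻ y in R, ENNReal.ofReal (w y)) ^ (p - 1) ≠ ⊤ :=
    ENNReal.rpow_ne_top_of_nonneg hp0.le
      (ENNReal.mul_ne_top (ENNReal.inv_ne_top.2 hR.volume_ne_zero)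
        (hw.1.lintegral_ne_top hR hRQ))
  have hbound (R) (hR : IsCube R) (hRQ : R ⊆ Q) : ∀ᵐ x ∂(volume.restrict R),
      ENNReal.ofReal (w x ^ (1 - p)) ≤ C ^ (p - 1) *
        (((volume R)⁻¹ * ∫⁻ y in R, ENNReal.ofReal (w y)) ^ (p - 1))⁻¹ := by
    filter_upwards [hav R hR hRQ, hw.1.pos_on hRQ] with x hx hpos
    have hpow := ENNReal.rpow_le_rpow hx hp0.le
    rw [ENNReal.mul_rpow_of_nonneg C _ hp0.le] at hpow
    rw [← ENNReal.ofReal_rpow_of_pos hpos, show 1 - p = -(p - 1) by ring, ENNReal.rpow_neg,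
      ENNReal.inv_le_iff_inv_le, ENNReal.mul_inv (Or.inr (ENNReal.inv_ne_top.2 (hnz R hR hRQ)))
        (Or.inr (ENNReal.inv_ne_zero.2 (hnt R hR hRQ))), inv_inv,
      mul_comm (C ^ (p - 1))⁻¹, ← div_eq_mul_inv]
    exact ENNReal.div_le_of_le_mul' hpow
  have hle (R) (hR : IsCube R) (hRQ : R ⊆ Q) :
      ∫⁻ x in R, ENNReal.ofReal (w x ^ (1 - p)) ≤ C ^ (p - 1) *
        (((volume R)⁻¹ * ∫⁻ y in R, ENNReal.ofReal (w y)) ^ (p - 1))⁻¹ * volume R :=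
    (lintegral_mono_ae (hbound R hR hRQ)).trans_eq (setLIntegral_const _ _)
  have hmeas : Measurable fun x => w x ^ (1 - p) := hw.1.measurable.pow_const _
  refine ⟨⟨hmeas, ?_, ?_⟩, C ^ (p - 1), ENNReal.rpow_ne_top_of_nonneg hp0.le hC, ?_⟩
  · filter_upwards [hw.1.pos] with x hx
    exact Real.rpow_pos_of_pos hx _
  · intro R hR hRQ
    refine ⟨hmeas.aestronglyMeasurable, ?_⟩
    rw [hasFiniteIntegral_iff_ofReal]
    · refine (hle R hR hRQ).trans_lt (ENNReal.mul_lt_top (ENNReal.mul_lt_top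
        (ENNReal.rpow_lt_top_of_nonneg hp0.le hC) ?_) hR.volume_ne_top.lt_top)
      exact (ENNReal.inv_ne_top.2 (hnz R hR hRQ)).lt_top
    · filter_upwards [hw.1.pos_on hRQ] with x hx
      exact (Real.rpow_pos_of_pos hx _).le
  · intro R hR hRQ
    have e : ∫⁻ x in R, ENNReal.ofReal ((w x ^ (1 - p)) ^ (1 - p / (p - 1))) =
        ∫⁻ x in R, ENNReal.ofReal (w x) := by
      refine lintegral_congr_ae ?_
      filter_upwards [hw.1.pos_on hRQ] with x hx
      rw [← Real.rpow_mul hx.le, show (1 - p) * (1 - p / (p - 1)) = 1 by field_simp; ring,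
        Real.rpow_one]
    rw [e]
    set a := ((volume R)⁻¹ * ∫⁻ y in R, ENNReal.ofReal (w y)) ^ (p - 1) with ha
    calc (volume R)⁻¹ * (∫⁻ x in R, ENNReal.ofReal (w x ^ (1 - p))) * a
        ≤ (volume R)⁻¹ * (C ^ (p - 1) * a⁻¹ * volume R) * a := by
          gcongr
          exact hle R hR hRQ
      _ = C ^ (p - 1) * ((volume R)⁻¹ * volume R) * (a⁻¹ * a) := by ring
      _ = C ^ (p - 1) := by
          rw [ENNReal.inv_mul_cancel hR.volume_ne_zero hR.volume_ne_top,
            ENNReal.inv_mul_cancel (hnz R hR hRQ) (hnt R hR hRQ), mul_one, mul_one]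

lemma ofReal_dual_weight {w p : ℝ} (hw : 0 < w) (hp : 1 < p) :
    ENNReal.ofReal (w ^ (1 - p / (p - 1))) ^ (p - 1) * ENNReal.ofReal w = 1 := by
  have hp0 : 0 < p - 1 := by linarith
  rw [ENNReal.ofReal_rpow_of_pos (Real.rpow_pos_of_pos hw _), ← Real.rpow_mul hw.le,
    ← ENNReal.ofReal_mul (by positivity), ← Real.rpow_add_one hw.ne',
    show (1 - p / (p - 1)) * (p - 1) + 1 = 0 by field_simp; ring]
  simp

/-- The dual weight of an `A_p` weight on a cube is integrable to some power larger than one. -/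
lemma MemApGT1.exists_lintegral_rpow_lt_top {Q : Set (Fin n → ℝ)} (hQ : IsCube Q)
    {w : (Fin n → ℝ) → ℝ} {p : ℝ} (hp : 1 < p) (hw : MemApGT1 Q p w) :
    ∃ ε : ℝ, 0 < ε ∧
      ∫⁻ x in Q, ENNReal.ofReal (w x ^ (1 - p / (p - 1))) ^ (1 + ε) < ⊤ := by
  obtain ⟨hW, C, hC, hAp⟩ := hw
  have hp0 : 0 < p - 1 := by linarith
  have hpp : 0 < p := by linarith
  have hSm : Measurable fun x => ENNReal.ofReal (w x ^ (1 - p / (p - 1))) :=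
    (hW.measurable.pow_const _).ennreal_ofReal
  have hWm : Measurable fun x => ENNReal.ofReal (w x) := hW.measurable.ennreal_ofReal
  have hprod (R) (hR : IsCube R) (hRQ : R ⊆ Q) :
      (∫⁻ x in R, ENNReal.ofReal (w x)) *
        (∫⁻ x in R, ENNReal.ofReal (w x ^ (1 - p / (p - 1)))) ^ (p - 1) ≤
      C * volume R ^ p := by
    set V := volume R with hV
    have hV0 : V ≠ 0 := hR.volume_ne_zero
    have hVt : V ≠ ⊤ := hR.volume_ne_top
    have h := hAp R hR hRQ
    rw [← hV, ENNReal.mul_rpow_of_nonneg _ _ hp0.le] at h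
    have e1 : V ^ p = V * V ^ (p - 1) := by
      conv_rhs => rw [← ENNReal.rpow_one V, ← ENNReal.rpow_mul, one_mul,
        ← ENNReal.rpow_add _ _ hV0 hVt]
      congr 1; ring
    have e2 : V⁻¹ ^ (p - 1) * V ^ (p - 1) = 1 := by
      rw [← ENNReal.mul_rpow_of_nonneg _ _ hp0.le, ENNReal.inv_mul_cancel hV0 hVt,
        ENNReal.one_rpow]
    set I := ∫⁻ x in R, ENNReal.ofReal (w x)
    set J := ∫⁻ x in R, ENNReal.ofReal (w x ^ (1 - p / (p - 1)))
    calc I * J ^ (p - 1) = (V⁻¹ * V) * (V⁻¹ ^ (p - 1) * V ^ (p - 1)) * (I * J ^ (p - 1)) := by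
          rw [e2, ENNReal.inv_mul_cancel hV0 hVt, one_mul, one_mul]
      _ = V⁻¹ * I * (V⁻¹ ^ (p - 1) * J ^ (p - 1)) * (V * V ^ (p - 1)) := by ring
      _ ≤ C * (V * V ^ (p - 1)) := by gcongr
      _ = C * V ^ p := by rw [e1]
  have hholder (F) (hFQ : F ⊆ Q) : volume F ^ p ≤ (∫⁻ x in F, ENNReal.ofReal (w x)) *
        (∫⁻ x in F, ENNReal.ofReal (w x ^ (1 - p / (p - 1)))) ^ (p - 1) := by
    have hpq : p.HolderConjugate (p / (p - 1)) := Real.HolderConjugate.conjExponent hp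
    have h := ENNReal.lintegral_mul_le_Lp_mul_Lq (volume.restrict F) hpq
      (hWm.pow_const (1 / p)).aemeasurable
      (hSm.pow_const (1 / (p / (p - 1)))).aemeasurable
    have e : ∫⁻ x in F, ((fun x => ENNReal.ofReal (w x) ^ (1 / p)) *
        fun x => ENNReal.ofReal (w x ^ (1 - p / (p - 1))) ^ (1 / (p / (p - 1)))) x = volume F := by
      rw [← setLIntegral_one F]
      refine lintegral_congr_ae ?_
      filter_upwards [hW.pos_on hFQ] with x hx
      rw [Pi.mul_apply, show 1 / (p / (p - 1)) = (p - 1) * (1 / p) by field_simp,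
        ENNReal.rpow_mul, ← ENNReal.mul_rpow_of_nonneg _ _ (by positivity), mul_comm,
        ofReal_dual_weight hx hp, ENNReal.one_rpow]
    rw [e] at h
    simp_rw [← ENNReal.rpow_mul] at h
    rw [show 1 / (p / (p - 1)) * (p / (p - 1)) = 1 by field_simp,
      show 1 / p * p = 1 by field_simp] at h
    simp_rw [ENNReal.rpow_one] at h
    refine (ENNReal.rpow_le_rpow h hpp.le).trans_eq ?_
    rw [ENNReal.mul_rpow_of_nonneg _ _ hpp.le, ← ENNReal.rpow_mul, ← ENNReal.rpow_mul,
      show 1 / p * p = 1 by field_simp, ENNReal.rpow_one,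
      show 1 / (p / (p - 1)) * p = p - 1 by field_simp]
  have hinv (a b : ℝ≥0∞) (h : a ^ (p - 1) ≤ b) : a ≤ b ^ (p - 1)⁻¹ := by
    have := ENNReal.rpow_le_rpow h (inv_nonneg.2 hp0.le)
    rwa [← ENNReal.rpow_mul, mul_inv_cancel₀ hp0.ne', ENNReal.rpow_one] at this
  refine hQ.exists_lintegral_rpow_lt_top hSm ?_ (K := (C * 2 ^ p) ^ (p - 1)⁻¹)
    (ENNReal.rpow_ne_top_of_nonneg (inv_nonneg.2 hp0.le) (ENNReal.mul_ne_top hC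
      (ENNReal.rpow_ne_top_of_nonneg hpp.le (by simp)))) ?_
  · intro htop
    have h := hprod Q hQ subset_rfl
    rw [htop, ENNReal.top_rpow_of_pos hp0,
      ENNReal.mul_top (hW.lintegral_ne_zero hQ subset_rfl)] at h
    exact (ENNReal.mul_ne_top hC (ENNReal.rpow_ne_top_of_nonneg hpp.le hQ.volume_ne_top))
      (top_le_iff.1 h)
  · intro R hR hRQ F hF hFR hvol
    set I := ∫⁻ x in R, ENNReal.ofReal (w x) with hI
    set J := ∫⁻ x in R, ENNReal.ofReal (w x ^ (1 - p / (p - 1)))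
    set JF := ∫⁻ x in F, ENNReal.ofReal (w x ^ (1 - p / (p - 1)))
    have h1 : I * J ^ (p - 1) ≤ I * (C * 2 ^ p * JF ^ (p - 1)) := by
      calc I * J ^ (p - 1) ≤ C * volume R ^ p := hprod R hR hRQ
        _ ≤ C * (2 * volume F) ^ p := by gcongr
        _ = C * 2 ^ p * volume F ^ p := by
          rw [ENNReal.mul_rpow_of_nonneg _ _ hpp.le, mul_assoc]
        _ ≤ C * 2 ^ p * ((∫⁻ x in F, ENNReal.ofReal (w x)) * JF ^ (p - 1)) := by
          gcongr
          exact hholder F (hFR.trans hRQ)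
        _ ≤ C * 2 ^ p * (I * JF ^ (p - 1)) := by
          gcongr
          exact lintegral_mono_set hFR
        _ = _ := by ring
    rw [ENNReal.mul_le_mul_iff_right (hW.lintegral_ne_zero hR hRQ)
      (hW.lintegral_ne_top hR hRQ)] at h1
    refine (hinv _ _ h1).trans_eq ?_
    rw [ENNReal.mul_rpow_of_nonneg _ _ (inv_nonneg.2 hp0.le), ← ENNReal.rpow_mul,
      mul_inv_cancel₀ hp0.ne', ENNReal.rpow_one]

lemma MemLw.exists_memLeb {Q : Set (Fin n → ℝ)} (hQ : IsCube Q) {w f : (Fin n → ℝ) → ℝ} {p : ℝ}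
    (hp : 1 < p) (hw : MemApGT1 Q p w) (hf : MemLw Q p w f) : ∃ s, 1 < s ∧ MemLeb Q s f := by
  obtain ⟨ε, hε, hS⟩ := hw.exists_lintegral_rpow_lt_top hQ hp
  have hpe : 0 < p + ε := by linarith
  have hp0 : 0 < p - 1 := by linarith
  have hSm : Measurable fun x => ENNReal.ofReal (w x ^ (1 - p / (p - 1))) :=
    (hw.1.measurable.pow_const _).ennreal_ofReal
  refine ⟨(1 + ε) * p / (p + ε), ?_, hf.1, ?_⟩
  · rw [one_lt_div hpe]
    nlinarith
  set s := (1 + ε) * p / (p + ε) with hs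
  have hs0 : 0 < s := by positivity
  have hsp : s * ((p - 1) / (1 + ε)) = p - s := by
    rw [hs]
    field_simp
    ring
  have hsp0 : 0 ≤ p - s := by rw [← hsp]; positivity
  calc ∫⁻ x in Q, ENNReal.ofReal |f x| ^ s * ENNReal.ofReal 1
      ≤ ∫⁻ x in Q, (ENNReal.ofReal (w x ^ (1 - p / (p - 1))) ^ (1 + ε) +
        ENNReal.ofReal |f x| ^ p * ENNReal.ofReal (w x)) := by
        refine lintegral_mono_ae ?_
        filter_upwards [hw.1.pos] with x hx
        rw [ENNReal.ofReal_one, mul_one]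
        have hd := ofReal_dual_weight hx hp
        set u := ENNReal.ofReal |f x|
        set S := ENNReal.ofReal (w x ^ (1 - p / (p - 1)))
        set W := ENNReal.ofReal (w x)
        rcases le_total (u ^ s) (S ^ (1 + ε)) with h | h
        · exact h.trans le_self_add
        · refine le_trans ?_ le_add_self
          have h2 : S ^ (p - 1) ≤ u ^ (p - s) := by
            have := ENNReal.rpow_le_rpow h (by positivity : 0 ≤ (p - 1) / (1 + ε))
            rwa [← ENNReal.rpow_mul, ← ENNReal.rpow_mul, hsp,
              show (1 + ε) * ((p - 1) / (1 + ε)) = p - 1 by field_simp] at this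
          calc u ^ s = u ^ s * (S ^ (p - 1) * W) := by rw [hd, mul_one]
            _ ≤ u ^ s * (u ^ (p - s) * W) := by gcongr
            _ = u ^ p * W := by
              rw [← mul_assoc, ← ENNReal.rpow_add_of_nonneg _ _ hs0.le hsp0, add_sub_cancel]
    _ < ⊤ := by
        rw [lintegral_add_left (hSm.pow_const _)]
        exact ENNReal.add_lt_top.2 ⟨hS, hf.2⟩

lemma MemLeb.hasApMajorant {Q : Set (Fin n → ℝ)} (hQ : IsCube Q) {f : (Fin n → ℝ) → ℝ} {p : ℝ}
    (hp : 1 < p) (hf : MemLeb Q p f) : HasApMajorant Q 1 f := by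
  obtain ⟨hfm, hfin⟩ := hf
  have hp0 : 0 < p := by linarith
  have hδ : 0 < 1 / p := by positivity
  have hδ1 : 1 / p < 1 := by rwa [div_lt_one hp0]
  set g : (Fin n → ℝ) → ℝ≥0∞ := Q.indicator fun x => max (ENNReal.ofReal |f x|) 1 ^ p with hgdef
  have hg : Measurable g := by
    refine Measurable.indicator ?_ hQ.measurableSet
    exact ((measurable_norm.comp hfm).ennreal_ofReal.max measurable_const).pow_const p
  have hgfin : ∫⁻ x, g x ≠ ⊤ := by
    rw [hgdef, lintegral_indicator hQ.measurableSet]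
    refine ne_of_lt ?_
    calc ∫⁻ x in Q, max (ENNReal.ofReal |f x|) 1 ^ p
        ≤ ∫⁻ x in Q, (1 + ENNReal.ofReal |f x| ^ p * ENNReal.ofReal 1) := by
          refine lintegral_mono fun x => ?_
          rcases le_total (ENNReal.ofReal |f x|) 1 with h | h
          · simp [max_eq_right h]
          · simp [max_eq_left h]
      _ < ⊤ := by
          rw [lintegral_add_left measurable_const, setLIntegral_one]
          exact ENNReal.add_lt_top.2 ⟨hQ.volume_ne_top.lt_top, hfin⟩
  have hgood : ∀ᵐ x ∂(volume.restrict Q), max (ENNReal.ofReal |f x|) 1 ^ p ≤ centredMaximal g x ∧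
      centredMaximal g x < ⊤ := by
    filter_upwards [ae_restrict_of_ae (ae_le_centredMaximal hg hgfin),
      ae_restrict_of_ae (ae_centredMaximal_lt_top hgfin),
      ae_restrict_mem hQ.measurableSet] with x h1 h2 hxQ
    exact ⟨by simpa [hgdef, hxQ] using h1, h2⟩
  have hroot {x} (h : max (ENNReal.ofReal |f x|) 1 ^ p ≤ centredMaximal g x) :
      max (ENNReal.ofReal |f x|) 1 ≤ centredMaximal g x ^ (1 / p) := by
    have := ENNReal.rpow_le_rpow h hδ.le
    rwa [← ENNReal.rpow_mul, mul_one_div_cancel hp0.ne', ENNReal.rpow_one] at this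
  set C := powMaximalConst n (1 / p)
  have hC : C ≠ ⊤ := powMaximalConst_ne_top n hδ hδ1
  set w : (Fin n → ℝ) → ℝ := fun x => (centredMaximal g x ^ (1 / p)).toReal with hw
  have hwm : Measurable w := ((measurable_centredMaximal hg).pow_const _).ennreal_toReal
  have hw0 (x) : 0 ≤ w x := ENNReal.toReal_nonneg
  have hkey (R) (hR : IsCube R) (hRQ : R ⊆ Q) (z) (hz : z ∈ R)
      (hz' : max (ENNReal.ofReal |f z|) 1 ^ p ≤ centredMaximal g z ∧ centredMaximal g z < ⊤) :
      ∫⁻ x in R, ENNReal.ofReal |w x| ≤ C * volume R * centredMaximal g z ^ (1 / p) := by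
    obtain ⟨c, r, hr, rfl⟩ := isCube_iff.1 hR
    have hz0 : centredMaximal g z ≠ 0 := by
      have : (1 : ℝ≥0∞) ≤ centredMaximal g z :=
        le_trans (ENNReal.one_le_rpow (le_max_right _ _) hp0) hz'.1
      exact (one_pos.trans_le this).ne'
    refine le_trans (lintegral_mono fun x => ?_)
      (lintegral_closedBall_rpow_centredMaximal_le hg hδ hr hz hz0 hz'.2.ne)
    rw [abs_of_nonneg (hw0 x)]
    exact ENNReal.ofReal_toReal_le
  refine ⟨hfm, w, Or.inl ⟨rfl, ⟨hwm, ?_, ?_⟩, C.toReal, ?_⟩, ?_⟩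
  · filter_upwards [hgood] with x hx
    refine ENNReal.toReal_pos ?_ (ENNReal.rpow_ne_top_of_nonneg hδ.le hx.2.ne)
    exact (one_pos.trans_le ((le_max_right _ _).trans (hroot hx.1))).ne'
  · intro R hR hRQ
    have : Filter.NeBot (ae (volume.restrict R)) := ae_restrict_neBot.2 hR.volume_ne_zero
    obtain ⟨z, hz, hz'⟩ := ((ae_restrict_mem hR.measurableSet).and
      (ae_restrict_of_ae_restrict_of_subset hRQ hgood)).exists
    refine ⟨hwm.aestronglyMeasurable, ?_⟩
    rw [hasFiniteIntegral_iff_norm]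
    refine (hkey R hR hRQ z hz hz').trans_lt ?_
    exact ENNReal.mul_lt_top (ENNReal.mul_lt_top hC.lt_top hR.volume_ne_top.lt_top)
      (ENNReal.rpow_lt_top_of_nonneg hδ.le hz'.2.ne)
  · filter_upwards [hgood] with x hx
    rw [maximal]
    refine iSup_le fun R => iSup_le fun hR => iSup_le fun hRQ => iSup_le fun hxR => ?_
    rw [ENNReal.ofReal_mul ENNReal.toReal_nonneg, ENNReal.ofReal_toReal hC,
      ENNReal.ofReal_toReal (ENNReal.rpow_ne_top_of_nonneg hδ.le hx.2.ne)]
    calc (volume R)⁻¹ * ∫⁻ y in R, ENNReal.ofReal |w y|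
        ≤ (volume R)⁻¹ * (C * volume R * centredMaximal g x ^ (1 / p)) := by
          gcongr
          exact hkey R hR hRQ x hxR hx
      _ = (volume R)⁻¹ * volume R * (C * centredMaximal g x ^ (1 / p)) := by ring
      _ = _ := by rw [ENNReal.inv_mul_cancel hR.volume_ne_zero hR.volume_ne_top, one_mul]
  · filter_upwards [hgood] with x hx
    rw [hw, ← ENNReal.ofReal_le_iff_le_toReal (ENNReal.rpow_ne_top_of_nonneg hδ.le hx.2.ne)]
    exact (le_max_left _ _).trans (hroot hx.1)

lemma HasApMajorant.exists_memA1 {Q : Set (Fin n → ℝ)} {f : (Fin n → ℝ) → ℝ}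
    (hf : HasApMajorant Q 1 f) :
    Measurable f ∧ ∃ w, MemA1 Q w ∧ ∀ᵐ x ∂(volume.restrict Q), |f x| ≤ w x := by
  obtain ⟨hfm, w, ⟨-, hw⟩ | ⟨h, -⟩, hle⟩ := hf
  · exact ⟨hfm, w, hw, hle⟩
  · exact absurd h (lt_irrefl 1)

lemma HasApMajorant.exists_memLeb {Q : Set (Fin n → ℝ)} (hQ : IsCube Q) {f : (Fin n → ℝ) → ℝ}
    (hf : HasApMajorant Q 1 f) : ∃ p, 1 < p ∧ MemLeb Q p f := by
  obtain ⟨hfm, w, hw, hle⟩ := hf.exists_memA1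
  obtain ⟨ε, hε, hfin⟩ := hw.exists_lintegral_rpow_lt_top hQ
  refine ⟨1 + ε, by linarith, hfm, (lintegral_mono_ae ?_).trans_lt hfin⟩
  filter_upwards [hle] with x hx
  rw [ENNReal.ofReal_one, mul_one]
  gcongr

lemma HasApMajorant.exists_memLw {Q : Set (Fin n → ℝ)} (hQ : IsCube Q) {f : (Fin n → ℝ) → ℝ}
    (hf : HasApMajorant Q 1 f) {p : ℝ} (hp : 1 < p) : ∃ w, MemA Q p w ∧ MemLw Q p w f := by
  obtain ⟨hfm, w, hw, hle⟩ := hf.exists_memA1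
  refine ⟨_, Or.inr ⟨hp, hw.memApGT1_rpow hp⟩, hfm,
    (lintegral_mono_ae ?_).trans_lt (hw.1.lintegral_ne_top hQ subset_rfl).lt_top⟩
  filter_upwards [hle, hw.1.pos] with x hx hpos
  calc ENNReal.ofReal |f x| ^ p * ENNReal.ofReal (w x ^ (1 - p))
      ≤ ENNReal.ofReal (w x) ^ p * ENNReal.ofReal (w x ^ (1 - p)) := by gcongr
    _ = ENNReal.ofReal (w x) := by
      rw [ENNReal.ofReal_rpow_of_pos hpos, ← ENNReal.ofReal_mul (by positivity),
        ← Real.rpow_add hpos, add_sub_cancel, Real.rpow_one]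

end Cubes

theorem stmt0 (n : ℕ) (Q : Set (Fin n → ℝ)) (hQ : IsCube Q) (p₀ : ℝ) (hp₀ : 1 < p₀) :
    {f : (Fin n → ℝ) → ℝ | HasApMajorant Q 1 f} =
      {f | ∃ p, 1 < p ∧ MemLeb Q p f} ∧
    {f : (Fin n → ℝ) → ℝ | ∃ p, 1 < p ∧ MemLeb Q p f} =
      {f | ∃ w, MemA Q p₀ w ∧ MemLw Q p₀ w f} := by
  refine ⟨Set.ext fun f => ⟨fun h => h.exists_memLeb hQ, ?_⟩, Set.ext fun f => ⟨?_, ?_⟩⟩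
  · rintro ⟨p, hp, h⟩
    exact h.hasApMajorant hQ hp
  · rintro ⟨p, hp, h⟩
    exact (h.hasApMajorant hQ hp).exists_memLw hQ hp₀
  · rintro ⟨w, ⟨h1, -⟩ | ⟨-, hw⟩, hf⟩
    · exact absurd h1 hp₀.ne'
    · exact hf.exists_memLeb hQ hp₀ hw
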